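/- arXiv:2411.04124 — 10 statements merged into one kernel-verified Lean document; each statement's English description precedes it below -/
import Mathlib

section
/- The columns of the matrix B produced by the Max-Cut-to-CVP reduction are linearly independent: if the edge list covers vertices, then the linear map ℝ^n → ℝ^{2m} given by B is injective (equivalently, B·x = 0 with x ∈ ℝ^n implies x = 0). -/
open Finset Matrix

/-- The matrix of the (unweighted) Max-Cut-to-CVP reduction. The ambient
dimension `2m` is indexed by `Fin m × Bool`, where `(k, false)` is the
coordinate `2k-1` and `(k, true)` is the coordinate `2k` of the paper. -/
noncomputable def Bmat {n m : ℕ} (ι : ℝ) (E : Fin m → Fin n × Fin n) :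
    Matrix (Fin m × Bool) (Fin n) ℝ := fun j i =>
  if j.2 then
    (if i = (E j.1).1 then ι else 0) + (if i = (E j.1).2 then ι else 0)
  else
    (if i = (E j.1).1 then (-1 : ℝ) else 0) + (if i = (E j.1).2 then 1 else 0)

/-- The target vector of the reduction: `t_{2k-1} = 0`, `t_{2k} = ι`. -/
noncomputable def tvec (m : ℕ) (ι : ℝ) : Fin m × Bool → ℝ := fun j => if j.2 then ι else 0

/-- The `ℓ_p` norm `(∑ j, |x j| ^ p) ^ (1/p)` (real exponents). -/
noncomputable def lpNorm {d : Type*} [Fintype d] (p : ℝ) (x : d → ℝ) : ℝ :=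
  (∑ j, |x j| ^ p) ^ (1 / p)

/-- A binary vector `b ∈ {0,1}^n`, as a real vector. -/
def binVec {n : ℕ} (b : Fin n → Bool) : Fin n → ℝ := fun i => if b i then 1 else 0

/-- An integer vector `y ∈ ℤ^n`, as a real vector. -/
def intVec {n : ℕ} (y : Fin n → ℤ) : Fin n → ℝ := fun i => (y i : ℝ)

/-- The number of edges cut by the partition described by `b`. -/
def cut {n m : ℕ} (E : Fin m → Fin n × Fin n) (b : Fin n → Bool) : ℕ :=
  (Finset.univ.filter fun k => b (E k).1 ≠ b (E k).2).card

/-- The edge list covers vertices: every vertex is an endpoint of some edge. -/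
def Covers {n m : ℕ} (E : Fin m → Fin n × Fin n) : Prop :=
  ∀ i : Fin n, ∃ k : Fin m, (E k).1 = i ∨ (E k).2 = i

/-- The binarization of an integer vector: `0` if `y i ≤ 0`, `1` if `y i ≥ 1`. -/
def binarize {n : ℕ} (y : Fin n → ℤ) : Fin n → Bool := fun i => decide (1 ≤ y i)

theorem Bmat_mulVec_false {n m : ℕ} (ι : ℝ) (E : Fin m → Fin n × Fin n) (x : Fin n → ℝ)
    (k : Fin m) : (Bmat ι E).mulVec x (k, false) = x (E k).2 - x (E k).1 := by
  simp [Matrix.mulVec, dotProduct, Bmat, add_mul, Finset.sum_add_distrib]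
  ring

theorem Bmat_mulVec_true {n m : ℕ} (ι : ℝ) (E : Fin m → Fin n × Fin n) (x : Fin n → ℝ)
    (k : Fin m) : (Bmat ι E).mulVec x (k, true) = ι * (x (E k).1 + x (E k).2) := by
  simp [Matrix.mulVec, dotProduct, Bmat, add_mul, Finset.sum_add_distrib]
  ring

/-- the columns of `B` are linearly independent, i.e. the linear map
`ℝ^n → ℝ^(2m)` given by `B` is injective: `B·x = 0` implies `x = 0`. -/
theorem stmt0 (n m : ℕ) (hn : 0 < n) (hm : 0 < m) (p : ℝ) (hp : 1 ≤ p) (ι : ℝ) (hι : 1 < ι)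
    (E : Fin m → Fin n × Fin n) (hE : ∀ k, (E k).1 ≠ (E k).2)
    (hcov : Covers E) :
    ∀ x : Fin n → ℝ, (Bmat ι E).mulVec x = 0 → x = 0 := by
  intro x hx
  funext i
  obtain ⟨k, hk⟩ := hcov i
  have hdiff : x (E k).2 - x (E k).1 = 0 := by
    rw [← Bmat_mulVec_false ι, hx, Pi.zero_apply]
  have hsum : x (E k).1 + x (E k).2 = 0 := by
    have h : ι * (x (E k).1 + x (E k).2) = 0 := by
      rw [← Bmat_mulVec_true, hx, Pi.zero_apply]
    exact (mul_eq_zero.mp h).resolve_left (by linarith)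
  rw [Pi.zero_apply]
  rcases hk with rfl | rfl <;> linarith
end

section
/- For every binary coefficient vector b ∈ {0,1}^n and every edge index k ∈ Fin m: if b cuts edge k then |(Bb − t)_{2k−1}| = 1 and (Bb − t)_{2k} = 0, while if b does not cut edge k then (Bb − t)_{2k−1} = 0 and |(Bb − t)_{2k}| = ι. -/
open Finset Matrix

/-- the components of `B·b − t` on the plane of edge `k`. -/
theorem stmt1 (n m : ℕ) (hn : 0 < n) (hm : 0 < m) (p : ℝ) (hp : 1 ≤ p) (ι : ℝ) (hι : 1 < ι)
    (E : Fin m → Fin n × Fin n) (hE : ∀ k, (E k).1 ≠ (E k).2)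
    (b : Fin n → Bool) (k : Fin m) :
    (b (E k).1 ≠ b (E k).2 →
      |((Bmat ι E).mulVec (binVec b) - tvec m ι) (k, false)| = 1 ∧
        ((Bmat ι E).mulVec (binVec b) - tvec m ι) (k, true) = 0) ∧
    (b (E k).1 = b (E k).2 →
      ((Bmat ι E).mulVec (binVec b) - tvec m ι) (k, false) = 0 ∧
        |((Bmat ι E).mulVec (binVec b) - tvec m ι) (k, true)| = ι) := by
  have hι_abs : |ι| = ι := abs_of_pos (by linarith)
  simp only [Pi.sub_apply, Bmat_mulVec_false, Bmat_mulVec_true, tvec, binVec]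
  cases b (E k).1 <;> cases b (E k).2 <;> simp [hι_abs, mul_add]
end

section
/- For every binary coefficient vector b ∈ {0,1}^n, the p-th power of the ℓ_p distance from Bb to the target equals the number of cut edges plus ι^p times the number of uncut edges: Σ_{j=1}^{2m} |(Bb − t)_j|^p = cut(b) + ι^p · (m − cut(b)). -/
open Finset Matrix

/-- The two coordinates of an edge contribute `1` if the edge is cut and `ι ^ p` otherwise. -/
theorem edge_contribution {n m : ℕ} {p ι : ℝ} (hp : p ≠ 0) (hι : 0 ≤ ι)
    (E : Fin m → Fin n × Fin n) (b : Fin n → Bool) (k : Fin m) :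
    |((Bmat ι E).mulVec (binVec b) - tvec m ι) (k, true)| ^ p
        + |((Bmat ι E).mulVec (binVec b) - tvec m ι) (k, false)| ^ p
      = if b (E k).1 ≠ b (E k).2 then 1 else ι ^ p := by
  have h : ι * (1 + 1) - ι = ι := by ring
  cases h₁ : b (E k).1 <;> cases h₂ : b (E k).2 <;>
    simp [Bmat_mulVec_false, Bmat_mulVec_true, binVec, tvec, h₁, h₂, h, Real.zero_rpow hp,
      abs_of_nonneg hι]

/-- `∑ j, |(B·b − t)_j|^p = cut(b) + ι^p · (m − cut(b))`. -/
theorem stmt2 (n m : ℕ) (hn : 0 < n) (hm : 0 < m) (p : ℝ) (hp : 1 ≤ p) (ι : ℝ) (hι : 1 < ι)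
    (E : Fin m → Fin n × Fin n) (hE : ∀ k, (E k).1 ≠ (E k).2)
    (b : Fin n → Bool) :
    ∑ j, |((Bmat ι E).mulVec (binVec b) - tvec m ι) j| ^ p
      = (cut E b : ℝ) + ι ^ p * ((m : ℝ) - (cut E b : ℝ)) := by
  have hcard : ((univ.filter fun k => ¬ b (E k).1 ≠ b (E k).2).card : ℝ) = m - cut E b := by
    rw [eq_sub_iff_add_eq', cut, ← Nat.cast_add, card_filter_add_card_filter_not, card_univ,
      Fintype.card_fin]
  simp only [Fintype.sum_prod_type, Fintype.sum_bool,
    edge_contribution (by linarith : p ≠ 0) (by linarith : 0 ≤ ι)]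
  rw [sum_ite, sum_const, sum_const, nsmul_eq_mul, nsmul_eq_mul, hcard, cut]
  ring
end

section
/- Binarization strictly decreases the distance to the target: if the edge list covers vertices and y ∈ ℤ^n has at least one entry not in {0,1}, then ‖B·ỹ − t‖_p < ‖B·y − t‖_p, where ỹ is the binarization of y. Consequently the closest lattice vector to t always has binary coordinates. -/
open Finset Matrix

theorem lpNorm_lt_lpNorm {d : Type*} [Fintype d] {p : ℝ} (hp : 0 < p) {x y : d → ℝ}
    (hle : ∀ j, |x j| ≤ |y j|) (hlt : ∃ j, |x j| < |y j|) : lpNorm p x < lpNorm p y := by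
  obtain ⟨j, hj⟩ := hlt
  refine Real.rpow_lt_rpow (Finset.sum_nonneg fun _ _ => by positivity) ?_ (by positivity)
  exact Finset.sum_lt_sum
    (fun k _ => Real.rpow_le_rpow (abs_nonneg _) (hle k) hp.le)
    ⟨j, Finset.mem_univ _, Real.rpow_lt_rpow (abs_nonneg _) hj hp⟩

theorem Bmat_mulVec_sub_tvec_false {n m : ℕ} (ι : ℝ) (E : Fin m → Fin n × Fin n)
    (x : Fin n → ℝ) (k : Fin m) :
    ((Bmat ι E).mulVec x - tvec m ι) (k, false) = x (E k).2 - x (E k).1 := by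
  simp [Bmat, tvec, Matrix.mulVec, dotProduct, add_mul, Finset.sum_add_distrib]
  ring

theorem Bmat_mulVec_sub_tvec_true {n m : ℕ} (ι : ℝ) (E : Fin m → Fin n × Fin n)
    (x : Fin n → ℝ) (k : Fin m) :
    ((Bmat ι E).mulVec x - tvec m ι) (k, true) = ι * (x (E k).1 + x (E k).2 - 1) := by
  simp [Bmat, tvec, Matrix.mulVec, dotProduct, add_mul, Finset.sum_add_distrib]
  ring

theorem binVec_eq_intVec {n : ℕ} (b : Fin n → Bool) :
    binVec b = intVec fun i => if b i then 1 else 0 := by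
  funext i
  simp [binVec, intVec]

theorem lpNorm_binarize_lt {n m : ℕ} {p ι : ℝ} (hp : 0 < p) (hι : 0 < ι)
    {E : Fin m → Fin n × Fin n} (hcov : Covers E) {y : Fin n → ℤ}
    (hy : ∃ i, y i ≠ 0 ∧ y i ≠ 1) :
    lpNorm p ((Bmat ι E).mulVec (binVec (binarize y)) - tvec m ι)
      < lpNorm p ((Bmat ι E).mulVec (intVec y) - tvec m ι) := by
  obtain ⟨i, hi⟩ := hy
  obtain ⟨k, hk⟩ := hcov i
  rw [binVec_eq_intVec]
  set z : Fin n → ℤ := fun i => if binarize y i then 1 else 0 with hz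
  have hz' : ∀ i, (y i ≤ 0 ∧ z i = 0) ∨ (1 ≤ y i ∧ z i = 1) := by
    intro i
    simp only [hz, binarize, decide_eq_true_eq]
    split_ifs <;> omega
  apply lpNorm_lt_lpNorm hp
  · rintro ⟨l, _ | _⟩
    · simp only [Bmat_mulVec_sub_tvec_false, intVec]
      have h : |z (E l).2 - z (E l).1| ≤ |y (E l).2 - y (E l).1| := by
        grind
      exact_mod_cast h
    · simp only [Bmat_mulVec_sub_tvec_true, intVec, abs_mul]
      have h : |z (E l).1 + z (E l).2 - 1| ≤ |y (E l).1 + y (E l).2 - 1| := by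
        grind
      exact mul_le_mul_of_nonneg_left (by exact_mod_cast h) (abs_nonneg ι)
  · have h : |z (E k).2 - z (E k).1| < |y (E k).2 - y (E k).1| ∨
        |z (E k).1 + z (E k).2 - 1| < |y (E k).1 + y (E k).2 - 1| := by
      have hi' : (y (E k).1 ≠ 0 ∧ y (E k).1 ≠ 1) ∨ (y (E k).2 ≠ 0 ∧ y (E k).2 ≠ 1) := by
        rcases hk with rfl | rfl
        · exact Or.inl hi
        · exact Or.inr hi
      have h₁ := hz' (E k).1
      have h₂ := hz' (E k).2
      clear_value z
      grind
    rcases h with h | h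
    · refine ⟨(k, false), ?_⟩
      simp only [Bmat_mulVec_sub_tvec_false, intVec]
      exact_mod_cast h
    · refine ⟨(k, true), ?_⟩
      simp only [Bmat_mulVec_sub_tvec_true, intVec, abs_mul]
      exact mul_lt_mul_of_pos_left (by exact_mod_cast h) (abs_pos.mpr hι.ne')


/-- binarization strictly decreases the distance to the target;
consequently the closest lattice vector to `t` always has binary coordinates. -/
theorem stmt3 (n m : ℕ) (hn : 0 < n) (hm : 0 < m) (p : ℝ) (hp : 1 ≤ p) (ι : ℝ) (hι : 1 < ι)
    (E : Fin m → Fin n × Fin n) (hE : ∀ k, (E k).1 ≠ (E k).2)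
    (hcov : Covers E) :
    (∀ y : Fin n → ℤ, (∃ i, y i ≠ 0 ∧ y i ≠ 1) →
      lpNorm p ((Bmat ι E).mulVec (binVec (binarize y)) - tvec m ι)
        < lpNorm p ((Bmat ι E).mulVec (intVec y) - tvec m ι)) ∧
    (∀ y : Fin n → ℤ,
      (∀ z : Fin n → ℤ,
        lpNorm p ((Bmat ι E).mulVec (intVec y) - tvec m ι)
          ≤ lpNorm p ((Bmat ι E).mulVec (intVec z) - tvec m ι)) →
      ∀ i, y i = 0 ∨ y i = 1) := by
  have key := fun (y : Fin n → ℤ) (hy : ∃ i, y i ≠ 0 ∧ y i ≠ 1) =>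
    lpNorm_binarize_lt (zero_lt_one.trans_le hp) (zero_lt_one.trans hι) hcov hy
  refine ⟨key, fun y hmin i => ?_⟩
  by_contra! hi
  have hlt := key y ⟨i, hi⟩
  rw [binVec_eq_intVec] at hlt
  exact (hmin _).not_gt hlt
end

section
/- If the edge list covers vertices, then for every y ∈ ℤ^n there exists a binary vector b ∈ {0,1}^n with ‖B·b − t‖_p ≤ ‖B·y − t‖_p; in particular, inf_{y ∈ ℤ^n} ‖B·y − t‖_p = min_{b ∈ {0,1}^n} ‖B·b − t‖_p, and this infimum is attained. -/
open Finset Matrix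

/-- Each coordinate of `B y - t` is determined by the endpoints of one edge. -/
theorem Bmat_mulVec_sub_tvec {n m : ℕ} (ι : ℝ) (E : Fin m → Fin n × Fin n) (x : Fin n → ℝ)
    (j : Fin m × Bool) :
    ((Bmat ι E).mulVec x - tvec m ι) j =
      if j.2 then ι * (x (E j.1).1 + x (E j.1).2 - 1) else x (E j.1).2 - x (E j.1).1 := by
  obtain ⟨k, c⟩ := j
  cases c
  · simp [Bmat, tvec, Matrix.mulVec, dotProduct, add_mul, Finset.sum_add_distrib]
    ring
  · simp [Bmat, tvec, Matrix.mulVec, dotProduct, add_mul, Finset.sum_add_distrib]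
    ring

theorem lpNorm_mono {d : Type*} [Fintype d] {p : ℝ} (hp : 0 ≤ p) {x y : d → ℝ}
    (h : ∀ j, |x j| ≤ |y j|) : lpNorm p x ≤ lpNorm p y :=
  Real.rpow_le_rpow (Finset.sum_nonneg fun _ _ => Real.rpow_nonneg (abs_nonneg _) _)
    (Finset.sum_le_sum fun j _ => Real.rpow_le_rpow (abs_nonneg _) (h j) hp)
    (one_div_nonneg.2 hp)

/-- A binary vector, as an integer vector. -/
def binInt {n : ℕ} (b : Fin n → Bool) : Fin n → ℤ := fun i => if b i then 1 else 0

theorem intVec_binInt {n : ℕ} (b : Fin n → Bool) : intVec (binInt b) = binVec b := by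
  funext i
  simp [intVec, binInt, binVec]

theorem abs_binInt_binarize_sub_le {n : ℕ} (y : Fin n → ℤ) (i j : Fin n) :
    |binInt (binarize y) j - binInt (binarize y) i| ≤ |y j - y i| := by
  simp only [binInt, binarize, decide_eq_true_eq]
  grind

theorem abs_binInt_binarize_add_sub_one_le {n : ℕ} (y : Fin n → ℤ) (i j : Fin n) :
    |binInt (binarize y) i + binInt (binarize y) j - 1| ≤ |y i + y j - 1| := by
  simp only [binInt, binarize, decide_eq_true_eq]
  grind

/-- Binarization does not increase the distance to the target in any coordinate. -/
theorem abs_binarize_coord_le {n m : ℕ} (ι : ℝ) (E : Fin m → Fin n × Fin n) (y : Fin n → ℤ)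
    (j : Fin m × Bool) :
    |((Bmat ι E).mulVec (binVec (binarize y)) - tvec m ι) j| ≤
      |((Bmat ι E).mulVec (intVec y) - tvec m ι) j| := by
  rw [Bmat_mulVec_sub_tvec, Bmat_mulVec_sub_tvec, ← intVec_binInt]
  simp only [intVec]
  split_ifs
  · rw [abs_mul, abs_mul]
    refine mul_le_mul_of_nonneg_left ?_ (abs_nonneg ι)
    exact_mod_cast abs_binInt_binarize_add_sub_one_le y (E j.1).1 (E j.1).2
  · exact_mod_cast abs_binInt_binarize_sub_le y (E j.1).1 (E j.1).2

theorem lpNorm_binarize_le {n m : ℕ} {p : ℝ} (hp : 0 ≤ p) (ι : ℝ) (E : Fin m → Fin n × Fin n)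
    (y : Fin n → ℤ) :
    lpNorm p ((Bmat ι E).mulVec (binVec (binarize y)) - tvec m ι) ≤
      lpNorm p ((Bmat ι E).mulVec (intVec y) - tvec m ι) :=
  lpNorm_mono hp (abs_binarize_coord_le ι E y)

/-- every lattice vector is dominated by a binary one, and the
infimum over `ℤ^n` of the distance equals the minimum over binary vectors,
which is attained. -/
theorem stmt4 (n m : ℕ) (hn : 0 < n) (hm : 0 < m) (p : ℝ) (hp : 1 ≤ p) (ι : ℝ) (hι : 1 < ι)
    (E : Fin m → Fin n × Fin n) (hE : ∀ k, (E k).1 ≠ (E k).2)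
    (hcov : Covers E) :
    (∀ y : Fin n → ℤ, ∃ b : Fin n → Bool,
      lpNorm p ((Bmat ι E).mulVec (binVec b) - tvec m ι)
        ≤ lpNorm p ((Bmat ι E).mulVec (intVec y) - tvec m ι)) ∧
    IsLeast {r : ℝ | ∃ y : Fin n → ℤ, r = lpNorm p ((Bmat ι E).mulVec (intVec y) - tvec m ι)}
      (Finset.univ.inf' Finset.univ_nonempty fun b : Fin n → Bool =>
        lpNorm p ((Bmat ι E).mulVec (binVec b) - tvec m ι)) := by
  have hp0 : 0 ≤ p := zero_le_one.trans hp
  refine ⟨fun y => ⟨binarize y, lpNorm_binarize_le hp0 ι E y⟩, ?_, ?_⟩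
  · obtain ⟨b, -, hb⟩ := Finset.exists_mem_eq_inf' Finset.univ_nonempty fun b : Fin n → Bool =>
      lpNorm p ((Bmat ι E).mulVec (binVec b) - tvec m ι)
    exact ⟨binInt b, by rw [hb, intVec_binInt]⟩
  · rintro _ ⟨y, rfl⟩
    exact (Finset.inf'_le _ (Finset.mem_univ (binarize y))).trans (lpNorm_binarize_le hp0 ι E y)
end

section
/- YES-instance soundness of the reduction: let ε ∈ (0,1). If there exists a binary vector b ∈ {0,1}^n with cut(b) ≥ (1−ε)·m, then ‖B·b − t‖_p ≤ (m·(1 + ε·(ι^p − 1)))^{1/p}; in particular there exists y ∈ ℤ^n whose lattice point lies within distance (m·(1 + ε·(ι^p − 1)))^{1/p} of the target t. -/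
open Finset Matrix

theorem Bmat_mulVec_apply {n m : ℕ} (ι : ℝ) (E : Fin m → Fin n × Fin n) (x : Fin n → ℝ)
    (k : Fin m) (c : Bool) :
    (Bmat ι E).mulVec x (k, c) =
      if c then ι * (x (E k).1 + x (E k).2) else x (E k).2 - x (E k).1 := by
  cases c <;> simp [Bmat, mulVec, dotProduct, add_mul, sum_add_distrib, ite_mul] <;> ring

theorem sum_abs_rpow_residual {n m : ℕ} {p : ℝ} (hp : p ≠ 0) {ι : ℝ} (hι : 0 ≤ ι)
    (E : Fin m → Fin n × Fin n) (b : Fin n → Bool) :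
    ∑ j, |((Bmat ι E).mulVec (binVec b) - tvec m ι) j| ^ p =
      m * ι ^ p - cut E b * (ι ^ p - 1) := by
  have edge_contribution (k : Fin m) :
      ∑ c, |((Bmat ι E).mulVec (binVec b) - tvec m ι) (k, c)| ^ p =
        ι ^ p - (if b (E k).1 ≠ b (E k).2 then 1 else 0) * (ι ^ p - 1) := by
    simp only [Fintype.sum_bool, Pi.sub_apply, Bmat_mulVec_apply, tvec, binVec]
    cases b (E k).1 <;> cases b (E k).2 <;>
      simp [Real.zero_rpow hp, abs_of_nonneg hι, mul_add]
  rw [Fintype.sum_prod_type, sum_congr rfl fun k _ => edge_contribution k, sum_sub_distrib,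
    ← sum_mul, sum_boole]
  simp [cut]

theorem intVec_ite {n : ℕ} (b : Fin n → Bool) :
    intVec (fun i => if b i then 1 else 0) = binVec b := by
  ext i
  simp [intVec, binVec]

/-- YES-instance soundness of the reduction. -/
theorem stmt5 (n m : ℕ) (hn : 0 < n) (hm : 0 < m) (p : ℝ) (hp : 1 ≤ p) (ι : ℝ) (hι : 1 < ι)
    (E : Fin m → Fin n × Fin n) (hE : ∀ k, (E k).1 ≠ (E k).2)
    (ε : ℝ) (hε : 0 < ε) (hε1 : ε < 1)
    (b : Fin n → Bool) (hb : (1 - ε) * (m : ℝ) ≤ (cut E b : ℝ)) :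
    lpNorm p ((Bmat ι E).mulVec (binVec b) - tvec m ι)
        ≤ ((m : ℝ) * (1 + ε * (ι ^ p - 1))) ^ (1 / p) ∧
    ∃ y : Fin n → ℤ, lpNorm p ((Bmat ι E).mulVec (intVec y) - tvec m ι)
        ≤ ((m : ℝ) * (1 + ε * (ι ^ p - 1))) ^ (1 / p) := by
  have bound : lpNorm p ((Bmat ι E).mulVec (binVec b) - tvec m ι)
      ≤ ((m : ℝ) * (1 + ε * (ι ^ p - 1))) ^ (1 / p) := by
    have hιp : 1 ≤ ι ^ p := Real.one_le_rpow hι.le (by linarith)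
    refine Real.rpow_le_rpow (sum_nonneg fun j _ => by positivity) ?_ (by positivity)
    rw [sum_abs_rpow_residual (by positivity) (by linarith)]
    linarith [mul_le_mul_of_nonneg_right hb (sub_nonneg.mpr hιp)]
  exact ⟨bound, fun i => if b i then 1 else 0, by rwa [intVec_ite]⟩
end

section
/- NO-instance soundness of the reduction: let ε, c ∈ (0,1) and suppose the edge list covers vertices. If every binary vector b ∈ {0,1}^n satisfies cut(b) < (1−ε^c)·m, then for every y ∈ ℤ^n one has ‖B·y − t‖_p > (m·(1 + ε^c·(ι^p − 1)))^{1/p}. -/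
open Finset Matrix

theorem one_le_abs_intCast_rpow {p : ℝ} (hp : 0 ≤ p) {z : ℤ} (hz : z ≠ 0) :
    1 ≤ |(z : ℝ)| ^ p :=
  Real.one_le_rpow (by exact_mod_cast Int.one_le_abs hz) hp

/-- The contribution of a single edge with endpoint values `a`, `b` to `‖B y - t‖_p ^ p`. -/
theorem edge_cost_ge {p ι : ℝ} (hp : 0 ≤ p) (hι : 1 ≤ ι) (a b : ℤ) :
    (if decide (1 ≤ a) ≠ decide (1 ≤ b) then 1 else ι ^ p) ≤
      |ι * ((a : ℝ) + b) - ι| ^ p + |(b : ℝ) - a| ^ p := by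
  have hιp : 1 ≤ ι ^ p := Real.one_le_rpow hι hp
  have hfirst : |ι * ((a : ℝ) + b) - ι| ^ p = ι ^ p * |((a + b - 1 : ℤ) : ℝ)| ^ p := by
    rw [← Real.mul_rpow (by positivity) (abs_nonneg _), ← abs_of_nonneg (zero_le_one.trans hι),
      ← abs_mul, abs_of_nonneg (zero_le_one.trans hι)]
    push_cast
    ring_nf
  by_cases h : a + b = 1
  · have hcut : decide (1 ≤ a) ≠ decide (1 ≤ b) := by
      rw [ne_eq, decide_eq_decide]
      omega
    have hdiff := one_le_abs_intCast_rpow hp (show b - a ≠ 0 by omega)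
    push_cast at hdiff
    rw [if_pos hcut]
    exact hdiff.trans (le_add_of_nonneg_left (by positivity))
  · have hsum := one_le_abs_intCast_rpow hp (show a + b - 1 ≠ 0 by omega)
    calc _ ≤ ι ^ p := by split_ifs <;> first | exact hιp | exact le_rfl
      _ ≤ |ι * ((a : ℝ) + b) - ι| ^ p := by
        rw [hfirst]
        exact le_mul_of_one_le_right (by positivity) hsum
      _ ≤ _ := le_add_of_nonneg_right (by positivity)

theorem sum_ite_cut {n m : ℕ} (E : Fin m → Fin n × Fin n) (b : Fin n → Bool) (r : ℝ) :
    ∑ k, (if b (E k).1 ≠ b (E k).2 then 1 else r) = m * r - cut E b * (r - 1) := by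
  have h (k : Fin m) : (if b (E k).1 ≠ b (E k).2 then 1 else r) =
      r - (if b (E k).1 ≠ b (E k).2 then 1 else 0) * (r - 1) := by
    split_ifs <;> ring
  rw [Finset.sum_congr rfl fun k _ => h k, Finset.sum_sub_distrib, ← Finset.sum_mul,
    Finset.sum_boole]
  simp [cut]

/-- NO-instance soundness of the reduction. -/
theorem stmt6 (n m : ℕ) (hn : 0 < n) (hm : 0 < m) (p : ℝ) (hp : 1 ≤ p) (ι : ℝ) (hι : 1 < ι)
    (E : Fin m → Fin n × Fin n) (hE : ∀ k, (E k).1 ≠ (E k).2)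
    (ε c : ℝ) (hε : 0 < ε) (hε1 : ε < 1) (hc : 0 < c) (hc1 : c < 1)
    (hcov : Covers E)
    (hno : ∀ b : Fin n → Bool, (cut E b : ℝ) < (1 - ε ^ c) * (m : ℝ)) :
    ∀ y : Fin n → ℤ,
      ((m : ℝ) * (1 + ε ^ c * (ι ^ p - 1))) ^ (1 / p)
        < lpNorm p ((Bmat ι E).mulVec (intVec y) - tvec m ι) := by
  intro y
  have hp0 : 0 < p := zero_lt_one.trans_le hp
  have hιp : 1 < ι ^ p := Real.one_lt_rpow hι hp0
  have hεc : 0 < ε ^ c := Real.rpow_pos_of_pos hε c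
  refine Real.rpow_lt_rpow (mul_nonneg m.cast_nonneg (add_nonneg zero_le_one
    (mul_nonneg hεc.le (sub_nonneg.2 hιp.le)))) ?_ (one_div_pos.2 hp0)
  calc (m : ℝ) * (1 + ε ^ c * (ι ^ p - 1))
      = m * ι ^ p - (1 - ε ^ c) * m * (ι ^ p - 1) := by ring
    _ < m * ι ^ p - cut E (binarize y) * (ι ^ p - 1) :=
        sub_lt_sub_left (mul_lt_mul_of_pos_right (hno _) (sub_pos.2 hιp)) _
    _ = ∑ k, (if binarize y (E k).1 ≠ binarize y (E k).2 then 1 else ι ^ p) :=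
        (sum_ite_cut E _ _).symm
    _ ≤ ∑ j, |((Bmat ι E).mulVec (intVec y) - tvec m ι) j| ^ p := by
        rw [Fintype.sum_prod_type]
        refine Finset.sum_le_sum fun k _ => ?_
        simp only [Fintype.sum_bool, Pi.sub_apply, Bmat_mulVec_true, Bmat_mulVec_false]
        simpa [tvec, intVec, binarize] using edge_cost_ge hp0.le hι.le (y (E k).1) (y (E k).2)
end

section
/- The columns of the matrix B produced by the weighted Max-Cut-to-CVP reduction are linearly independent: if the edge list covers vertices, then the linear map ℝ^n → ℝ^{2m} given by B is injective (equivalently, B·x = 0 with x ∈ ℝ^n implies x = 0). -/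
open Finset Matrix

/-- The matrix of the weighted Max-Cut-to-CVP reduction, with `ω k = (w k)^(1/p)`.
The ambient dimension `2m` is indexed by `Fin m × Bool`, where `(k, false)` is the
coordinate `2k-1` and `(k, true)` is the coordinate `2k` of the paper. -/
noncomputable def BmatW {n m : ℕ} (p ι : ℝ) (E : Fin m → Fin n × Fin n) (w : Fin m → ℝ) :
    Matrix (Fin m × Bool) (Fin n) ℝ := fun j i =>
  if j.2 then
    (if i = (E j.1).1 then ι * (w j.1) ^ (1 / p) else 0) +
      (if i = (E j.1).2 then ι * (w j.1) ^ (1 / p) else 0)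
  else
    (if i = (E j.1).1 then (-1 : ℝ) else 0) + (if i = (E j.1).2 then 1 else 0)

/-- The target vector of the weighted reduction: `t_{2k-1} = 0`, `t_{2k} = ι·ω k`. -/
noncomputable def tvecW (m : ℕ) (p ι : ℝ) (w : Fin m → ℝ) : Fin m × Bool → ℝ :=
  fun j => if j.2 then ι * (w j.1) ^ (1 / p) else 0

/-- The odd coordinates of `B x` are the differences of `x` along the edges. -/
theorem BmatW_mulVec_false {n m : ℕ} (p ι : ℝ) (E : Fin m → Fin n × Fin n) (w : Fin m → ℝ)
    (x : Fin n → ℝ) (k : Fin m) :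
    (BmatW p ι E w).mulVec x (k, false) = x (E k).2 - x (E k).1 := by
  simp [Matrix.mulVec, dotProduct, BmatW, add_mul, Finset.sum_add_distrib]
  ring

/-- The even coordinates of `B x` are the scaled sums of `x` along the edges. -/
theorem BmatW_mulVec_true {n m : ℕ} (p ι : ℝ) (E : Fin m → Fin n × Fin n) (w : Fin m → ℝ)
    (x : Fin n → ℝ) (k : Fin m) :
    (BmatW p ι E w).mulVec x (k, true) = ι * w k ^ (1 / p) * (x (E k).1 + x (E k).2) := by
  simp [Matrix.mulVec, dotProduct, BmatW, add_mul, Finset.sum_add_distrib]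
  ring

/-- the columns of the weighted reduction matrix `B` are linearly
independent: `B·x = 0` implies `x = 0`. -/
theorem stmt11 (n m : ℕ) (hn : 0 < n) (hm : 0 < m) (p : ℝ) (hp : 1 ≤ p) (ι : ℝ) (hι : 1 < ι)
    (E : Fin m → Fin n × Fin n) (hE : ∀ k, (E k).1 ≠ (E k).2)
    (w : Fin m → ℝ) (hw : ∀ k, 1 ≤ w k)
    (hcov : Covers E) :
    ∀ x : Fin n → ℝ, (BmatW p ι E w).mulVec x = 0 → x = 0 := by
  intro x hx
  funext i
  obtain ⟨k, hk⟩ := hcov i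
  have hdiff := congrFun hx (k, false)
  have hsum := congrFun hx (k, true)
  rw [BmatW_mulVec_false, Pi.zero_apply] at hdiff
  rw [BmatW_mulVec_true, Pi.zero_apply] at hsum
  have hscale : ι * w k ^ (1 / p) ≠ 0 :=
    (mul_pos (by linarith) (Real.rpow_pos_of_pos (by linarith [hw k]) _)).ne'
  have hadd := (mul_eq_zero.mp hsum).resolve_left hscale
  rw [Pi.zero_apply]
  rcases hk with rfl | rfl <;> linarith
end

section
/- Binarization strictly decreases the distance to the target in the weighted reduction: if the edge list covers vertices and y ∈ ℤ^n has at least one entry not in {0,1}, then ‖B·ỹ − t‖_p < ‖B·y − t‖_p, where ỹ is the binarization of y. Consequently the closest lattice vector to t always has binary coordinates. -/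
open Finset Matrix

/-- The indicator of `1 ≤ x`, which is the entrywise effect of `binarize`. -/
def clip (x : ℤ) : ℤ := if 1 ≤ x then 1 else 0

theorem binVec_binarize {n : ℕ} (y : Fin n → ℤ) :
    binVec (binarize y) = intVec fun i => clip (y i) := by
  funext i
  by_cases h : 1 ≤ y i <;> simp [binVec, binarize, intVec, clip, h]

theorem abs_clip_sub_le (a b : ℤ) : |clip b - clip a| ≤ |b - a| := by
  unfold clip
  grind

theorem abs_clip_add_le (a b : ℤ) : |clip a + clip b - 1| ≤ |a + b - 1| := by
  unfold clip
  grind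

theorem abs_clip_lt (a b : ℤ) (h : (a ≠ 0 ∧ a ≠ 1) ∨ (b ≠ 0 ∧ b ≠ 1)) :
    |clip b - clip a| < |b - a| ∨ |clip a + clip b - 1| < |a + b - 1| := by
  unfold clip
  grind

theorem residual_false {n m : ℕ} (p ι : ℝ) (E : Fin m → Fin n × Fin n) (w : Fin m → ℝ)
    (y : Fin n → ℤ) (k : Fin m) :
    |((BmatW p ι E w).mulVec (intVec y) - tvecW m p ι w) (k, false)|
      = ((|y (E k).2 - y (E k).1| : ℤ) : ℝ) := by
  simp [BmatW, tvecW, intVec, Matrix.mulVec, dotProduct, add_mul, Finset.sum_add_distrib,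
    neg_add_eq_sub]

theorem residual_true {n m : ℕ} {p ι : ℝ} (E : Fin m → Fin n × Fin n) {w : Fin m → ℝ}
    (y : Fin n → ℤ) {k : Fin m} (hC : 0 < ι * w k ^ (1 / p)) :
    |((BmatW p ι E w).mulVec (intVec y) - tvecW m p ι w) (k, true)|
      = ι * w k ^ (1 / p) * ((|y (E k).1 + y (E k).2 - 1| : ℤ) : ℝ) := by
  rw [Int.cast_abs, ← abs_of_pos hC, ← abs_mul]
  congr 1
  simp [BmatW, tvecW, intVec, Matrix.mulVec, dotProduct, add_mul, Finset.sum_add_distrib]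
  ring

/-- binarization strictly decreases the distance to the target in the
weighted reduction; consequently the closest lattice vector has binary coordinates. -/
theorem stmt12 (n m : ℕ) (hn : 0 < n) (hm : 0 < m) (p : ℝ) (hp : 1 ≤ p) (ι : ℝ) (hι : 1 < ι)
    (E : Fin m → Fin n × Fin n) (hE : ∀ k, (E k).1 ≠ (E k).2)
    (w : Fin m → ℝ) (hw : ∀ k, 1 ≤ w k)
    (hcov : Covers E) :
    (∀ y : Fin n → ℤ, (∃ i, y i ≠ 0 ∧ y i ≠ 1) →
      lpNorm p ((BmatW p ι E w).mulVec (binVec (binarize y)) - tvecW m p ι w)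
        < lpNorm p ((BmatW p ι E w).mulVec (intVec y) - tvecW m p ι w)) ∧
    (∀ y : Fin n → ℤ,
      (∀ z : Fin n → ℤ,
        lpNorm p ((BmatW p ι E w).mulVec (intVec y) - tvecW m p ι w)
          ≤ lpNorm p ((BmatW p ι E w).mulVec (intVec z) - tvecW m p ι w)) →
      ∀ i, y i = 0 ∨ y i = 1) := by
  have hC : ∀ k, 0 < ι * w k ^ (1 / p) := fun k =>
    mul_pos (by linarith) (Real.rpow_pos_of_pos (by linarith [hw k]) _)
  have key : ∀ y : Fin n → ℤ, (∃ i, y i ≠ 0 ∧ y i ≠ 1) →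
      lpNorm p ((BmatW p ι E w).mulVec (binVec (binarize y)) - tvecW m p ι w)
        < lpNorm p ((BmatW p ι E w).mulVec (intVec y) - tvecW m p ι w) := by
    rintro y ⟨i, hi⟩
    rw [binVec_binarize]
    apply lpNorm_lt_lpNorm (by linarith)
    · rintro ⟨k, _ | _⟩
      · rw [residual_false, residual_false]
        exact_mod_cast abs_clip_sub_le _ _
      · rw [residual_true E _ (hC k), residual_true E _ (hC k)]
        exact mul_le_mul_of_nonneg_left (by exact_mod_cast abs_clip_add_le _ _) (hC k).le
    · obtain ⟨k, hk⟩ := hcov i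
      have h : (y (E k).1 ≠ 0 ∧ y (E k).1 ≠ 1) ∨ (y (E k).2 ≠ 0 ∧ y (E k).2 ≠ 1) := by
        rcases hk with rfl | rfl
        · exact Or.inl hi
        · exact Or.inr hi
      rcases abs_clip_lt _ _ h with h | h
      · refine ⟨(k, false), ?_⟩
        rw [residual_false, residual_false]
        exact_mod_cast h
      · refine ⟨(k, true), ?_⟩
        rw [residual_true E _ (hC k), residual_true E _ (hC k)]
        exact mul_lt_mul_of_pos_left (by exact_mod_cast h) (hC k)
  refine ⟨key, fun y hy i => ?_⟩
  by_contra! hi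
  have h := key y ⟨i, hi⟩
  rw [binVec_binarize] at h
  exact (hy _).not_gt h
end

section
/- In the weighted reduction, if the edge list covers vertices, then the minimum over all y ∈ ℤ^n of Σ_{j=1}^{2m} |(B·y − t)_j|^p exists and equals the minimum over all binary vectors b ∈ {0,1}^n of cut(b) + ι^p · Σ_{k : b does not cut edge k} w k; that is, the p-th power of the distance from the lattice generated by B to the target t equals the minimum over all vertex partitions of (number of cut edges) + ι^p · (total weight of uncut edges). -/
open Finset Matrix

/-- The `ℓ_p` cost of an integer vector, written as a sum over the edges. -/
theorem sum_abs_rpow_eq_sum_edges {n m : ℕ} {p ι : ℝ} (hp : 0 < p) (hι : 0 ≤ ι)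
    (E : Fin m → Fin n × Fin n) {w : Fin m → ℝ} (hw : ∀ k, 0 ≤ w k) (y : Fin n → ℤ) :
    ∑ j, |((BmatW p ι E w).mulVec (intVec y) - tvecW m p ι w) j| ^ p =
      ∑ k, (|((y (E k).2 - y (E k).1 : ℤ) : ℝ)| ^ p +
        ι ^ p * w k * |((y (E k).1 + y (E k).2 - 1 : ℤ) : ℝ)| ^ p) := by
  rw [Fintype.sum_prod_type]
  refine Finset.sum_congr rfl fun k _ => ?_
  have hodd : ((BmatW p ι E w).mulVec (intVec y) - tvecW m p ι w) (k, false) =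
      ((y (E k).2 - y (E k).1 : ℤ) : ℝ) := by
    simp [mulVec, dotProduct, BmatW, tvecW, intVec, add_mul, Finset.sum_add_distrib]
    ring
  have heven : ((BmatW p ι E w).mulVec (intVec y) - tvecW m p ι w) (k, true) =
      ι * w k ^ (1 / p) * ((y (E k).1 + y (E k).2 - 1 : ℤ) : ℝ) := by
    simp [mulVec, dotProduct, BmatW, tvecW, intVec, add_mul, Finset.sum_add_distrib]
    ring
  have hω : 0 ≤ w k ^ (1 / p) := Real.rpow_nonneg (hw k) _
  rw [Fintype.sum_bool, hodd, heven, abs_mul, abs_of_nonneg (mul_nonneg hι hω),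
    Real.mul_rpow (mul_nonneg hι hω) (abs_nonneg _), Real.mul_rpow hι hω,
    ← Real.rpow_mul (hw k), one_div_mul_cancel hp.ne', Real.rpow_one, add_comm]

/-- The cost of a partition, written as a sum over the edges. -/
theorem cut_add_eq_sum_edges {n m : ℕ} (E : Fin m → Fin n × Fin n) (w : Fin m → ℝ) (c : ℝ)
    (b : Fin n → Bool) :
    (cut E b : ℝ) + c * ∑ k ∈ Finset.univ.filter (fun k => b (E k).1 = b (E k).2), w k =
      ∑ k, if b (E k).1 = b (E k).2 then c * w k else 1 := by
  rw [Finset.sum_ite, Finset.mul_sum, add_comm]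
  simp [cut]

/-- On a single edge, binarizing an integer vector does not increase the cost. -/
theorem edge_cost_binarize_le {n : ℕ} {p c : ℝ} (hp : 0 ≤ p) (hc : 0 ≤ c) (y : Fin n → ℤ)
    (i j : Fin n) :
    (if binarize y i = binarize y j then c else 1) ≤
      |((y j - y i : ℤ) : ℝ)| ^ p + c * |((y i + y j - 1 : ℤ) : ℝ)| ^ p := by
  have hdiff : 0 ≤ |((y j - y i : ℤ) : ℝ)| ^ p := Real.rpow_nonneg (abs_nonneg _) _
  have hsum : 0 ≤ |((y i + y j - 1 : ℤ) : ℝ)| ^ p := Real.rpow_nonneg (abs_nonneg _) _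
  split_ifs with h <;> simp only [binarize, decide_eq_decide] at h
  · have hone := one_le_abs_intCast_rpow hp (z := y i + y j - 1) (by omega)
    linarith [mul_le_mul_of_nonneg_left hone hc]
  · have hone := one_le_abs_intCast_rpow hp (z := y j - y i) fun h0 => h (by omega)
    linarith [mul_nonneg hc hsum]

/-- The cost of a binary vector on a single edge. -/
theorem edge_cost_toInt {n : ℕ} {p : ℝ} (hp : p ≠ 0) (c : ℝ) (b : Fin n → Bool) (i j : Fin n) :
    |(((b j).toInt - (b i).toInt : ℤ) : ℝ)| ^ p +
        c * |(((b i).toInt + (b j).toInt - 1 : ℤ) : ℝ)| ^ p =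
      if b i = b j then c else 1 := by
  cases b i <;> cases b j <;> simp [hp]

/-- the minimum over `y ∈ ℤ^n` of `∑ j, |(B·y − t)_j|^p` exists and
equals the minimum over binary vectors `b` of
`cut(b) + ι^p · (total weight of uncut edges)`. -/
theorem stmt15 (n m : ℕ) (hn : 0 < n) (hm : 0 < m) (p : ℝ) (hp : 1 ≤ p) (ι : ℝ) (hι : 1 < ι)
    (E : Fin m → Fin n × Fin n) (hE : ∀ k, (E k).1 ≠ (E k).2)
    (w : Fin m → ℝ) (hw : ∀ k, 1 ≤ w k)
    (hcov : Covers E) :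
    IsLeast {r : ℝ | ∃ y : Fin n → ℤ,
        r = ∑ j, |((BmatW p ι E w).mulVec (intVec y) - tvecW m p ι w) j| ^ p}
      (Finset.univ.inf' Finset.univ_nonempty fun b : Fin n → Bool =>
        (cut E b : ℝ) +
          ι ^ p * ∑ k ∈ Finset.univ.filter (fun k => b (E k).1 = b (E k).2), w k) := by
  have hp0 : 0 < p := by linarith
  have hι0 : 0 ≤ ι := by linarith
  have hw0 : ∀ k, 0 ≤ w k := fun k => zero_le_one.trans (hw k)
  simp only [sum_abs_rpow_eq_sum_edges hp0 hι0 E hw0, cut_add_eq_sum_edges]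
  refine ⟨?_, ?_⟩
  · obtain ⟨b, -, hb⟩ := Finset.exists_mem_eq_inf' Finset.univ_nonempty fun b : Fin n → Bool =>
      ∑ k, if b (E k).1 = b (E k).2 then ι ^ p * w k else 1
    exact ⟨fun i => (b i).toInt, hb.trans <| Finset.sum_congr rfl fun k _ =>
      (edge_cost_toInt hp0.ne' _ b _ _).symm⟩
  · rintro _ ⟨y, rfl⟩
    exact (Finset.inf'_le _ (Finset.mem_univ (binarize y))).trans <|
      Finset.sum_le_sum fun k _ => edge_cost_binarize_le hp0.le
        (mul_nonneg (Real.rpow_nonneg hι0 p) (hw0 k)) y _ _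
end
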